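/- Let 0<q<1 be real, h'1,h'2,l'1,l'2,α'1,α'2,β' real with h'1+h'2−l'1−l'2−α'1−α'2+β'+2 = 0, let t1,t2,ξ be nonzero complex numbers and E' ∈ ℂ. Assume h satisfies (A⟨4⟩(s; h'1,h'2,l'1,l'2,α'1,α'2,β')h)(s) = E'·h(s) for all s ∈ {q^{n}ξ : n∈ℤ}, that h(q^{L}ξ) → 0 as the integer L → +∞, and that h(q^{K}ξ)/(q^{K}ξ)^{−α'1} → 0 as the integer K → −∞. Then for every nonzero complex x with x ∉ {q^{n}ξ : n∈ℤ}, the Jackson integral g(x) = ∫₀^{ξ∞} h(s)·(q^{2−α'1}s/x;q)_∞/(s/x;q)_∞ d_q s converges and satisfies (A⟨4⟩(x; h'1+1−α'1, h'2+1−α'1, l'1, l'2, 0, α'2−1, β'+1−α'1)g)(x) = q^{−α'1}·E'·g(x). -/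

import Mathlib

open Filter Topology

/-- The infinite q-Pochhammer symbol `(a;q)_∞ = ∏_{j=0}^∞ (1 - q^j a)`. -/
noncomputable def qPochInf (q : ℝ) (a : ℂ) : ℂ := ∏' j : ℕ, (1 - (q : ℂ) ^ j * a)

/-- `q^r` for a real exponent `r`, using the principal branch of the complex power. -/
noncomputable def qpow (q : ℝ) (r : ℝ) : ℂ := (q : ℂ) ^ (r : ℂ)

/-- The fourth degenerate Ruijsenaars–van Diejen operator `A⟨4⟩` applied to `g` at `x`. -/
noncomputable def A4 (q : ℝ) (t1 t2 : ℂ) (h1 h2 l1 l2 a1 a2 b : ℝ) (g : ℂ → ℂ) (x : ℂ) : ℂ :=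
  x⁻¹ * (x - qpow q (h1 + 1/2) * t1) * (x - qpow q (h2 + 1/2) * t2) * g (x / (q : ℂ))
    + qpow q (a1 + a2) * x⁻¹ * (x - qpow q (l1 - 1/2) * t1) * (x - qpow q (l2 - 1/2) * t2) *
        g ((q : ℂ) * x)
    - ((qpow q a1 + qpow q a2) * x
        + qpow q ((h1 + h2 + l1 + l2 + a1 + a2) / 2) * (qpow q (b / 2) + qpow q (-(b / 2))) *
            t1 * t2 * x⁻¹) * g x

/-- The bilateral series `Σ_{n∈ℤ} f n` converges to `S`: the series over `n ≥ 0` and the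
series over `n < 0` both converge, with sum `S`. -/
def HasBilatSum (f : ℤ → ℂ) (S : ℂ) : Prop :=
  ∃ Sp Sm : ℂ,
    Filter.Tendsto (fun N : ℕ => ∑ n ∈ Finset.range N, f n) Filter.atTop (nhds Sp) ∧
    Filter.Tendsto (fun N : ℕ => ∑ n ∈ Finset.range N, f (-(n : ℤ) - 1)) Filter.atTop (nhds Sm) ∧
    S = Sp + Sm

open Asymptotics

theorem qPochInf_eq_mul {q : ℝ} (hq0 : 0 < q) (hq1 : q < 1) (a : ℂ) :
    qPochInf q a = (1 - a) * qPochInf q (q * a) := by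
  have hq : ‖(q : ℂ)‖ < 1 := by simpa [abs_of_pos hq0] using hq1
  have hsum : Summable fun j : ℕ => ‖-((q : ℂ) ^ (j + 1) * a)‖ := by
    have := ((summable_geometric_of_norm_lt_one hq).norm.mul_right ‖(q : ℂ) * a‖)
    refine this.congr fun j => ?_
    rw [norm_neg, ← norm_mul, pow_succ, mul_assoc]
  have hm : Multipliable fun j : ℕ => 1 - (q : ℂ) ^ (j + 1) * a :=
    (multipliable_one_add_of_summable hsum).congr fun j => (sub_eq_add_neg _ _).symm
  calc qPochInf q a = (1 - (q : ℂ) ^ 0 * a) * ∏' j : ℕ, (1 - (q : ℂ) ^ (j + 1) * a) :=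
        tprod_eq_zero_mul' (f := fun j : ℕ => 1 - (q : ℂ) ^ j * a) hm
    _ = _ := by
        rw [pow_zero, one_mul, qPochInf]
        congr 1
        exact tprod_congr fun j => by rw [pow_succ, mul_assoc]

theorem qpow_add {q : ℝ} (hq0 : 0 < q) (r s : ℝ) : qpow q (r + s) = qpow q r * qpow q s := by
  have : (q : ℂ) ≠ 0 := by exact_mod_cast hq0.ne'
  simp [qpow, Complex.cpow_add _ _ this]

theorem qpow_ne_zero {q : ℝ} (hq0 : 0 < q) (r : ℝ) : qpow q r ≠ 0 := by
  have : (q : ℂ) ≠ 0 := by exact_mod_cast hq0.ne'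
  simp [qpow, Complex.cpow_eq_zero_iff, this]

theorem qpow_sub {q : ℝ} (hq0 : 0 < q) (r s : ℝ) : qpow q (r - s) = qpow q r / qpow q s := by
  rw [eq_div_iff (qpow_ne_zero hq0 s), ← qpow_add hq0, sub_add_cancel]

theorem qpow_zero (q : ℝ) : qpow q 0 = 1 := by simp [qpow]

theorem qpow_neg {q : ℝ} (hq0 : 0 < q) (r : ℝ) : qpow q (-r) = (qpow q r)⁻¹ := by
  rw [← zero_sub, qpow_sub hq0, qpow_zero, one_div]

theorem qpow_one (q : ℝ) : qpow q 1 = q := by simp [qpow]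

theorem qpow_two {q : ℝ} (hq0 : 0 < q) : qpow q 2 = (q : ℂ) ^ 2 := by
  rw [← one_add_one_eq_two, qpow_add hq0, qpow_one, pow_two]

theorem norm_qpow {q : ℝ} (hq0 : 0 < q) (r : ℝ) : ‖qpow q r‖ = q ^ r := by
  rw [qpow, Complex.norm_cpow_real, Complex.norm_real, Real.norm_of_nonneg hq0.le]

/-- The kernel `(c u; q)_∞ / (u; q)_∞`. -/
noncomputable def qKernel (q : ℝ) (c u : ℂ) : ℂ := qPochInf q (c * u) / qPochInf q u

theorem qKernel_mul_one_sub {q : ℝ} (hq0 : 0 < q) (hq1 : q < 1) (c : ℂ) {u : ℂ} (hu : u ≠ 1) :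
    qKernel q c u * (1 - u) = qKernel q c (q * u) * (1 - c * u) := by
  have h1 : 1 - u ≠ 0 := sub_ne_zero.2 hu.symm
  unfold qKernel
  rw [qPochInf_eq_mul hq0 hq1 u, qPochInf_eq_mul hq0 hq1 (c * u), mul_left_comm c]
  rw [div_mul_eq_mul_div, mul_comm _ (1 - u), mul_div_mul_left _ _ h1]
  ring

/-- Three consecutive values of the kernel on a `q`-orbit share a common factor. -/
theorem exists_qKernel_eq {q : ℝ} (hq0 : 0 < q) (hq1 : q < 1) (c : ℂ) {v : ℂ}
    (hv : v ≠ 1) (hqv : q * v ≠ 1) :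
    ∃ M : ℂ, qKernel q c (q * (q * v)) = M * (1 - v) * (1 - q * v) ∧
      qKernel q c (q * v) = M * (1 - v) * (1 - c * (q * v)) ∧
      qKernel q c v = M * (1 - c * v) * (1 - c * (q * v)) := by
  have h1 : 1 - v ≠ 0 := sub_ne_zero.2 hv.symm
  have h2 : 1 - q * v ≠ 0 := sub_ne_zero.2 hqv.symm
  have e1 := qKernel_mul_one_sub hq0 hq1 c hv
  have e2 := qKernel_mul_one_sub hq0 hq1 c hqv
  refine ⟨qKernel q c (q * (q * v)) / ((1 - v) * (1 - q * v)), ?_, ?_, ?_⟩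
  · field_simp
  · rw [← mul_left_inj' h2, e2]
    field_simp
  · rw [← mul_left_inj' (mul_ne_zero h1 h2), ← mul_assoc, e1, mul_right_comm, e2]
    field_simp

/-- Solutions of `k (n+1) (1 - d qⁿ) = k n (1 - c qⁿ)` are bounded. -/
theorem isBigO_one_of_recurrence {q : ℝ} (hq0 : 0 < q) (hq1 : q < 1) (c d : ℂ) (k : ℕ → ℂ)
    (hk : ∀ n, k (n + 1) * (1 - d * (q : ℂ) ^ n) = k n * (1 - c * (q : ℂ) ^ n)) :
    k =O[atTop] (fun _ => (1 : ℝ)) := by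
  have hlim : Tendsto (fun n : ℕ => ‖d‖ * q ^ n) atTop (𝓝 0) := by
    simpa using (tendsto_pow_atTop_nhds_zero_of_lt_one hq0.le hq1).const_mul ‖d‖
  obtain ⟨N, hN⟩ := eventually_atTop.1 (hlim.eventually_le_const (show (0 : ℝ) < 1 / 2 by norm_num))
  set C := ‖c‖ + 2 * ‖d‖ with hC
  have hstep : ∀ n ≥ N, ‖k (n + 1)‖ ≤ ‖k n‖ * Real.exp (C * q ^ n) := by
    intro n hn
    have hqn : 0 < q ^ n := pow_pos hq0 n
    have hd := hN n hn
    have hlow : 1 - ‖d‖ * q ^ n ≤ ‖1 - d * (q : ℂ) ^ n‖ := by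
      have := norm_sub_norm_le (1 : ℂ) (d * (q : ℂ) ^ n)
      simpa [abs_of_pos hq0] using this
    have hup : ‖1 - c * (q : ℂ) ^ n‖ ≤ 1 + ‖c‖ * q ^ n := by
      have := norm_sub_le (1 : ℂ) (c * (q : ℂ) ^ n)
      simpa [abs_of_pos hq0] using this
    have hd0 : 0 ≤ ‖d‖ * q ^ n := by positivity
    have hc0 : 0 ≤ ‖c‖ * q ^ n := by positivity
    have h1 : ‖k (n + 1)‖ * (1 - ‖d‖ * q ^ n) ≤ ‖k n‖ * (1 + ‖c‖ * q ^ n) := by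
      calc _ ≤ ‖k (n + 1)‖ * ‖1 - d * (q : ℂ) ^ n‖ := by gcongr
        _ = ‖k n‖ * ‖1 - c * (q : ℂ) ^ n‖ := by rw [← norm_mul, hk, norm_mul]
        _ ≤ _ := by gcongr
    have h2 : 1 ≤ (1 - ‖d‖ * q ^ n) * (1 + 2 * (‖d‖ * q ^ n)) := by nlinarith
    calc ‖k (n + 1)‖ ≤ ‖k (n + 1)‖ * ((1 - ‖d‖ * q ^ n) * (1 + 2 * (‖d‖ * q ^ n))) :=
          le_mul_of_one_le_right (norm_nonneg _) h2
      _ = ‖k (n + 1)‖ * (1 - ‖d‖ * q ^ n) * (1 + 2 * (‖d‖ * q ^ n)) := by ring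
      _ ≤ ‖k n‖ * (1 + ‖c‖ * q ^ n) * (1 + 2 * (‖d‖ * q ^ n)) := by gcongr
      _ ≤ ‖k n‖ * Real.exp (‖c‖ * q ^ n) * Real.exp (2 * (‖d‖ * q ^ n)) := by
          gcongr
          · rw [add_comm]; exact Real.add_one_le_exp _
          · rw [add_comm]; exact Real.add_one_le_exp _
      _ = ‖k n‖ * Real.exp (C * q ^ n) := by
          rw [mul_assoc, ← Real.exp_add, hC]; ring_nf
  have hq1' : 0 < 1 - q := by linarith
  have hmono : ∀ n ≥ N, ‖k n‖ * Real.exp (C * q ^ n / (1 - q)) ≤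
      ‖k N‖ * Real.exp (C * q ^ N / (1 - q)) := by
    intro n hn
    induction n, hn using Nat.le_induction with
    | base => rfl
    | succ n hn ih =>
      refine le_trans ?_ ih
      calc _ ≤ ‖k n‖ * Real.exp (C * q ^ n) * Real.exp (C * q ^ (n + 1) / (1 - q)) := by
            gcongr; exact hstep n hn
        _ = _ := by
            rw [mul_assoc, ← Real.exp_add]
            congr 2
            field_simp
            ring
  refine IsBigO.of_bound (‖k N‖ * Real.exp (C * q ^ N / (1 - q))) ?_
  filter_upwards [eventually_ge_atTop N] with n hn
  have h1 : 1 ≤ Real.exp (C * q ^ n / (1 - q)) := Real.one_le_exp (by positivity)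
  simpa using (le_mul_of_one_le_right (norm_nonneg _) h1).trans (hmono n hn)

theorem map_neg_natCast_atTop : map (fun n : ℕ => -(n : ℤ)) atTop = atBot := by
  have h : map (fun n : ℤ => -n) atTop = atBot := (OrderIso.neg ℤ).map_atTop
  rw [← h, ← Nat.map_cast_int_atTop, map_map]
  rfl

theorem qKernel_isBigO_atTop {q : ℝ} (hq0 : 0 < q) (hq1 : q < 1) (c : ℂ) {u : ℂ}
    (hu : ∀ n : ℤ, (q : ℂ) ^ n * u ≠ 1) :
    (fun n : ℤ => qKernel q c ((q : ℂ) ^ n * u)) =O[atTop] (fun _ => (1 : ℝ)) := by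
  rw [← Nat.map_cast_int_atTop, isBigO_map]
  refine isBigO_one_of_recurrence hq0 hq1 u (c * u) _ fun n => ?_
  have := qKernel_mul_one_sub hq0 hq1 c (hu n)
  simp only [Function.comp_apply, zpow_natCast, pow_succ'] at this ⊢
  rw [mul_comm u, this]
  ring_nf

theorem qKernel_isBigO_atBot {q : ℝ} (hq0 : 0 < q) (hq1 : q < 1) {c : ℂ} (hc : c ≠ 0) {u : ℂ}
    (hu0 : u ≠ 0) (hu : ∀ n : ℤ, (q : ℂ) ^ n * u ≠ 1) :
    (fun n : ℤ => c ^ n * qKernel q c ((q : ℂ) ^ n * u)) =O[atBot] (fun _ => (1 : ℝ)) := by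
  have hq : (q : ℂ) ≠ 0 := by exact_mod_cast hq0.ne'
  rw [← map_neg_natCast_atTop, isBigO_map]
  refine isBigO_one_of_recurrence hq0 hq1 (q / (c * u)) (q / u) _ fun n => ?_
  have := qKernel_mul_one_sub hq0 hq1 c (hu (-((n + 1 : ℕ) : ℤ)))
  have e : (q : ℂ) * ((q : ℂ) ^ (-((n + 1 : ℕ) : ℤ)) * u) = (q : ℂ) ^ (-(n : ℤ)) * u := by
    rw [← mul_assoc, ← zpow_one_add₀ hq]
    congr 2
    push_cast
    ring
  rw [e] at this
  simp only [Function.comp_apply]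
  generalize qKernel q c ((q : ℂ) ^ (-((n + 1 : ℕ) : ℤ)) * u) = A at this ⊢
  generalize qKernel q c ((q : ℂ) ^ (-(n : ℤ)) * u) = B at this ⊢
  simp only [zpow_neg, zpow_natCast, pow_succ] at this ⊢
  field_simp at this ⊢
  linear_combination (-1 : ℂ) * this

namespace HasBilatSum

variable {f g : ℤ → ℂ} {S T : ℂ}

theorem add (hf : HasBilatSum f S) (hg : HasBilatSum g T) :
    HasBilatSum (fun n => f n + g n) (S + T) := by
  obtain ⟨a, b, ha, hb, rfl⟩ := hf
  obtain ⟨c, d, hc, hd, rfl⟩ := hg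
  refine ⟨a + c, b + d, ?_, ?_, by ring⟩
  · simpa only [Finset.sum_add_distrib] using ha.add hc
  · simpa only [Finset.sum_add_distrib] using hb.add hd

theorem const_mul (c : ℂ) (hf : HasBilatSum f S) : HasBilatSum (fun n => c * f n) (c * S) := by
  obtain ⟨a, b, ha, hb, rfl⟩ := hf
  refine ⟨c * a, c * b, ?_, ?_, by ring⟩
  · simpa only [Finset.mul_sum] using ha.const_mul c
  · simpa only [Finset.mul_sum] using hb.const_mul c

theorem unique (hf : HasBilatSum f S) (hg : HasBilatSum f T) : S = T := by
  obtain ⟨a, b, ha, hb, rfl⟩ := hf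
  obtain ⟨c, d, hc, hd, rfl⟩ := hg
  rw [tendsto_nhds_unique ha hc, tendsto_nhds_unique hb hd]

theorem of_summable (h1 : Summable fun n : ℕ => f n) (h2 : Summable fun n : ℕ => f (-(n : ℤ) - 1)) :
    HasBilatSum f ((∑' n : ℕ, f n) + ∑' n : ℕ, f (-(n : ℤ) - 1)) :=
  ⟨_, _, h1.hasSum.tendsto_sum_nat, h2.hasSum.tendsto_sum_nat, rfl⟩

theorem telescope {G : ℤ → ℂ} (h1 : Tendsto G atTop (𝓝 0)) (h2 : Tendsto G atBot (𝓝 0)) :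
    HasBilatSum (fun n => G (n + 1) - G n) 0 := by
  refine ⟨-G 0, G 0, ?_, ?_, by ring⟩
  · have e : ∀ N : ℕ, ∑ n ∈ Finset.range N, (G ((n : ℤ) + 1) - G n) = G N - G 0 := fun N => by
      simpa using Finset.sum_range_sub (fun n : ℕ => G n) N
    simp only [e]
    simpa using (h1.comp tendsto_natCast_atTop_atTop).sub_const (G 0)
  · have e : ∀ N : ℕ, ∑ n ∈ Finset.range N, (G (-(n : ℤ) - 1 + 1) - G (-(n : ℤ) - 1)) =
        G 0 - G (-(N : ℤ)) := fun N => by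
      have := Finset.sum_range_sub' (fun n : ℕ => G (-(n : ℤ))) N
      simp only [Nat.cast_zero, neg_zero] at this
      rw [← this]
      refine Finset.sum_congr rfl fun n _ => ?_
      congr 2
      · ring
      · push_cast; ring
    simp only [e]
    rw [← map_neg_natCast_atTop, tendsto_map'_iff] at h2
    simpa using h2.const_sub (G 0)

end HasBilatSum

/-- The pointwise identity expressing that the kernel intertwines the two operators up to a
telescoping difference. -/
theorem kernel_telescoping_identity {Q s x a : ℂ} (b H1 H2 L1 L2 M h0 h1 h2 E v c : ℂ)
    (hQ : Q ≠ 0) (hs : s ≠ 0) (hx : x ≠ 0) (ha : a ≠ 0) (hv : v = s / x / Q) (hc : c = Q ^ 2 / a)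
    (heig : s⁻¹ * (s - H1) * (s - H2) * h0 + a * b * s⁻¹ * (s - L1) * (s - L2) * h2
      - ((a + b) * s + (a * b * L1 * L2 + H1 * H2) * s⁻¹) * h1 = E * h1) :
    x⁻¹ * (x - Q / a * H1) * (x - Q / a * H2) * (s * (h1 * (M * (1 - v) * (1 - Q * v))))
      + b / Q * x⁻¹ * (x - L1) * (x - L2) * (s * (h1 * (M * (1 - c * v) * (1 - c * (Q * v)))))
      - ((1 + b / Q) * x + (b * Q / a * L1 * L2 + H1 * H2 / a) * x⁻¹)
        * (s * (h1 * (M * (1 - v) * (1 - c * (Q * v)))))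
      - a⁻¹ * E * (s * (h1 * (M * (1 - v) * (1 - c * (Q * v)))))
    = (-b * (s - L1) * (s - L2) * h2 * (M * (1 - v) * (1 - c * (Q * v)))
        + a⁻¹ * (Q * s - H1) * (Q * s - H2) * h1 * (M * (1 - v) * (1 - Q * v)))
      - (-b * (s / Q - L1) * (s / Q - L2) * h1 * (M * (1 - c * v) * (1 - c * (Q * v)))
        + a⁻¹ * (s - H1) * (s - H2) * h0 * (M * (1 - v) * (1 - c * (Q * v)))) := by
  subst hv hc
  linear_combination (norm := skip)
    (a⁻¹ * s * (M * (1 - s / x / Q) * (1 - Q ^ 2 / a * (Q * (s / x / Q))))) * heig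
  field_simp
  ring

section Decay

variable {q : ℝ} {ξ y : ℂ}

theorem tendsto_zpow_mul_atTop (hq0 : 0 < q) (hq1 : q < 1) (ξ : ℂ) :
    Tendsto (fun n : ℤ => (q : ℂ) ^ n * ξ) atTop (𝓝 0) := by
  have hq : ‖(q : ℂ)‖ < 1 := by simpa [abs_of_pos hq0] using hq1
  rw [← Nat.map_cast_int_atTop, tendsto_map'_iff]
  simpa [Function.comp_def] using (tendsto_pow_atTop_nhds_zero_of_norm_lt_one hq).mul_const ξ

theorem tendsto_inv_zpow_mul_atBot (hq0 : 0 < q) (hq1 : q < 1) (ξ : ℂ) :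
    Tendsto (fun n : ℤ => ((q : ℂ) ^ n * ξ)⁻¹) atBot (𝓝 0) := by
  have hq : ‖(q : ℂ)‖ < 1 := by simpa [abs_of_pos hq0] using hq1
  rw [← map_neg_natCast_atTop, tendsto_map'_iff]
  simpa [Function.comp_def, mul_comm] using
    (tendsto_pow_atTop_nhds_zero_of_norm_lt_one hq).mul_const ξ⁻¹

theorem zpow_mul_div_ne_one (hy : y ≠ 0) (hyn : ∀ n : ℤ, y ≠ (q : ℂ) ^ n * ξ) (n : ℤ) :
    (q : ℂ) ^ n * (ξ / y) ≠ 1 := by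
  rw [← mul_div_assoc, Ne, div_eq_one_iff_eq hy]
  exact (hyn n).symm

theorem tendsto_mul_qKernel_atTop (hq0 : 0 < q) (hq1 : q < 1) (c : ℂ) (hy : y ≠ 0)
    (hyn : ∀ n : ℤ, y ≠ (q : ℂ) ^ n * ξ) {h : ℂ → ℂ}
    (hh : Tendsto (fun n : ℤ => h ((q : ℂ) ^ n * ξ)) atTop (𝓝 0)) :
    Tendsto (fun n : ℤ => h ((q : ℂ) ^ n * ξ) * qKernel q c ((q : ℂ) ^ n * ξ / y))
      atTop (𝓝 0) := by
  have hK := qKernel_isBigO_atTop hq0 hq1 c (zpow_mul_div_ne_one hy hyn)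
  rw [← isLittleO_one_iff ℝ] at hh ⊢
  simpa [mul_div_assoc] using hh.mul_isBigO hK

theorem tendsto_sq_mul_qKernel_atBot (hq0 : 0 < q) (hq1 : q < 1) (a : ℝ) (hξ : ξ ≠ 0)
    (hy : y ≠ 0) (hyn : ∀ n : ℤ, y ≠ (q : ℂ) ^ n * ξ) {h : ℂ → ℂ}
    (hh : Tendsto (fun n : ℤ => h ((q : ℂ) ^ n * ξ) / ((q : ℂ) ^ n * ξ) ^ ((-a : ℝ) : ℂ))
      atBot (𝓝 0)) :
    Tendsto (fun n : ℤ => ((q : ℂ) ^ n * ξ) ^ 2 *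
      (h ((q : ℂ) ^ n * ξ) * qKernel q (qpow q (2 - a)) ((q : ℂ) ^ n * ξ / y))) atBot (𝓝 0) := by
  have hq : (q : ℂ) ≠ 0 := by exact_mod_cast hq0.ne'
  have hK := qKernel_isBigO_atBot hq0 hq1 (qpow_ne_zero hq0 (2 - a)) (div_ne_zero hξ hy)
    (zpow_mul_div_ne_one hy hyn)
  have hP : (fun n : ℤ => ((q : ℂ) ^ n * ξ) ^ 2 * ((q : ℂ) ^ n * ξ) ^ ((-a : ℝ) : ℂ)) =O[atBot]
      (fun n : ℤ => qpow q (2 - a) ^ n) := by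
    refine IsBigO.of_bound (‖ξ‖ ^ (2 - a)) (Eventually.of_forall fun n => le_of_eq ?_)
    have hqn : 0 < q ^ n := zpow_pos hq0 n
    have hξ' : 0 < ‖ξ‖ := norm_pos_iff.2 hξ
    rw [norm_mul, norm_pow, Complex.norm_cpow_real, norm_zpow, norm_qpow hq0, norm_mul, norm_zpow,
      Complex.norm_real, Real.norm_of_nonneg hq0.le, ← Real.rpow_natCast,
      ← Real.rpow_add (by positivity), Nat.cast_ofNat, ← sub_eq_add_neg,
      Real.mul_rpow hqn.le hξ'.le, mul_comm, ← Real.rpow_intCast, ← Real.rpow_intCast,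
      ← Real.rpow_mul hq0.le, ← Real.rpow_mul hq0.le, mul_comm (n : ℝ)]
  have hPK : (fun n : ℤ => ((q : ℂ) ^ n * ξ) ^ 2 * ((q : ℂ) ^ n * ξ) ^ ((-a : ℝ) : ℂ) *
      qKernel q (qpow q (2 - a)) ((q : ℂ) ^ n * ξ / y)) =O[atBot] (fun _ => (1 : ℝ)) := by
    refine (hP.mul (isBigO_refl _ _)).trans ?_
    simpa only [mul_div_assoc] using hK
  rw [← isLittleO_one_iff ℝ] at hh ⊢
  have := hh.mul_isBigO hPK
  simp only [mul_one] at this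
  refine this.congr_left fun n => ?_
  have hs : ((q : ℂ) ^ n * ξ) ^ ((-a : ℝ) : ℂ) ≠ 0 := by
    simp [Complex.cpow_eq_zero_iff, hq, hξ, zpow_ne_zero]
  field_simp

theorem tendsto_quadratic_mul_atTop (hq0 : 0 < q) (hq1 : q < 1) (ξ p A B : ℂ) {T : ℤ → ℂ}
    (hT : Tendsto T atTop (𝓝 0)) :
    Tendsto (fun n : ℤ => (p * ((q : ℂ) ^ n * ξ) - A) * (p * ((q : ℂ) ^ n * ξ) - B) * T n)
      atTop (𝓝 0) := by
  have hs := (tendsto_zpow_mul_atTop hq0 hq1 ξ).const_mul p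
  simpa using ((hs.sub_const A).mul (hs.sub_const B)).mul hT

theorem tendsto_quadratic_mul_atBot (hq0 : 0 < q) (hq1 : q < 1) (hξ : ξ ≠ 0) (p A B : ℂ)
    {T : ℤ → ℂ} (hT : Tendsto (fun n => ((q : ℂ) ^ n * ξ) ^ 2 * T n) atBot (𝓝 0)) :
    Tendsto (fun n : ℤ => (p * ((q : ℂ) ^ n * ξ) - A) * (p * ((q : ℂ) ^ n * ξ) - B) * T n)
      atBot (𝓝 0) := by
  have hq : (q : ℂ) ≠ 0 := by exact_mod_cast hq0.ne'
  have hs := tendsto_inv_zpow_mul_atBot hq0 hq1 ξ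
  have := (((hs.const_mul A).const_sub p).mul ((hs.const_mul B).const_sub p)).mul hT
  rw [mul_zero] at this
  refine this.congr fun n => ?_
  have hs : (q : ℂ) ^ n * ξ ≠ 0 := mul_ne_zero (zpow_ne_zero n hq) hξ
  generalize (q : ℂ) ^ n * ξ = s at hs ⊢
  field_simp

theorem exists_hasBilatSum_of_decay (hq0 : 0 < q) (hq1 : q < 1) (hξ : ξ ≠ 0) {T : ℤ → ℂ}
    (h1 : Tendsto T atTop (𝓝 0))
    (h2 : Tendsto (fun n => ((q : ℂ) ^ n * ξ) ^ 2 * T n) atBot (𝓝 0)) :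
    ∃ S, HasBilatSum (fun n => (1 - (q : ℂ)) * ((q : ℂ) ^ n * ξ) * T n) S := by
  have hq : (q : ℂ) ≠ 0 := by exact_mod_cast hq0.ne'
  have hgeom : Summable fun n : ℕ => q ^ n := summable_geometric_of_lt_one hq0.le hq1
  refine ⟨_, HasBilatSum.of_summable ?_ ?_⟩
  · refine summable_of_isBigO_nat hgeom ?_
    have hT : (fun n : ℕ => T n) =O[atTop] (fun _ => (1 : ℝ)) :=
      (h1.comp tendsto_natCast_atTop_atTop).isBigO_one ℝ
    have hs : (fun n : ℕ => (1 - (q : ℂ)) * ((q : ℂ) ^ (n : ℤ) * ξ)) =O[atTop]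
        (fun n : ℕ => q ^ n) := by
      refine IsBigO.of_bound (‖1 - (q : ℂ)‖ * ‖ξ‖) (Eventually.of_forall fun n => le_of_eq ?_)
      simp
      ring
    simpa using hs.mul hT
  · refine summable_of_isBigO_nat hgeom ?_
    have hlim : Tendsto (fun n : ℕ => -(n : ℤ) - 1) atTop atBot :=
      tendsto_atBot_add_const_right _ _ (tendsto_neg_atTop_atBot.comp tendsto_natCast_atTop_atTop)
    have hT := (h2.comp hlim).isBigO_one ℝ
    have hs : (fun n : ℕ => (1 - (q : ℂ)) * ((q : ℂ) ^ (-(n : ℤ) - 1) * ξ)⁻¹) =O[atTop]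
        (fun n : ℕ => q ^ n) := by
      refine IsBigO.of_bound (‖1 - (q : ℂ)‖ * ‖(q : ℂ)‖ * ‖ξ‖⁻¹)
        (Eventually.of_forall fun n => le_of_eq ?_)
      rw [zpow_sub₀ hq]
      simp
      ring
    have := hs.mul hT
    simp only [mul_one] at this
    refine this.congr_left fun n => ?_
    have hs : (q : ℂ) ^ (-(n : ℤ) - 1) * ξ ≠ 0 := mul_ne_zero (zpow_ne_zero _ hq) hξ
    simp only [Function.comp_apply]
    generalize (q : ℂ) ^ (-(n : ℤ) - 1) * ξ = s at hs ⊢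
    field_simp

end Decay

theorem stmt13 (q : ℝ) (hq0 : 0 < q) (hq1 : q < 1)
    (h1' h2' l1' l2' a1' a2' b' : ℝ)
    (hzero : h1' + h2' - l1' - l2' - a1' - a2' + b' + 2 = 0)
    (t1 t2 ξ : ℂ) (ht1 : t1 ≠ 0) (ht2 : t2 ≠ 0) (hξ : ξ ≠ 0) (E' : ℂ)
    (h : ℂ → ℂ)
    (heig : ∀ n : ℤ, A4 q t1 t2 h1' h2' l1' l2' a1' a2' b' h ((q : ℂ) ^ n * ξ)
      = E' * h ((q : ℂ) ^ n * ξ))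
    (hC1 : Filter.Tendsto (fun L : ℤ => h ((q : ℂ) ^ L * ξ)) Filter.atTop (nhds 0))
    (hC2 : Filter.Tendsto
      (fun K : ℤ => h ((q : ℂ) ^ K * ξ) / ((q : ℂ) ^ K * ξ) ^ ((-a1' : ℝ) : ℂ))
      Filter.atBot (nhds 0)) :
    ∃ g : ℂ → ℂ,
      (∀ y : ℂ, y ≠ 0 → (∀ n : ℤ, y ≠ (q : ℂ) ^ n * ξ) →
        HasBilatSum (fun n : ℤ =>
          (1 - (q : ℂ)) * ((q : ℂ) ^ n * ξ) *
            (h ((q : ℂ) ^ n * ξ) *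
              (qPochInf q (qpow q (2 - a1') * ((q : ℂ) ^ n * ξ) / y) /
                qPochInf q (((q : ℂ) ^ n * ξ) / y)))) (g y)) ∧
      (∀ x : ℂ, x ≠ 0 → (∀ n : ℤ, x ≠ (q : ℂ) ^ n * ξ) →
        A4 q t1 t2 (h1' + 1 - a1') (h2' + 1 - a1') l1' l2' 0 (a2' - 1) (b' + 1 - a1') g x
          = qpow q (-a1') * E' * g x) := by
  have hQ : (q : ℂ) ≠ 0 := by exact_mod_cast hq0.ne'
  set c := qpow q (2 - a1') with hc
  have hc' : c = (q : ℂ) ^ 2 / qpow q a1' := by rw [hc, qpow_sub hq0, qpow_two hq0]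
  set T : ℂ → ℤ → ℂ := fun y n =>
    h ((q : ℂ) ^ n * ξ) * qKernel q c ((q : ℂ) ^ n * ξ / y) with hT
  have hTtop : ∀ y : ℂ, y ≠ 0 → (∀ n : ℤ, y ≠ (q : ℂ) ^ n * ξ) → Tendsto (T y) atTop (𝓝 0) :=
    fun y hy hyn => tendsto_mul_qKernel_atTop hq0 hq1 c hy hyn hC1
  have hTbot : ∀ y : ℂ, y ≠ 0 → (∀ n : ℤ, y ≠ (q : ℂ) ^ n * ξ) →
      Tendsto (fun n => ((q : ℂ) ^ n * ξ) ^ 2 * T y n) atBot (𝓝 0) :=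
    fun y hy hyn => tendsto_sq_mul_qKernel_atBot hq0 hq1 a1' hξ hy hyn hC2
  have hex : ∀ y : ℂ, ∃ S, y ≠ 0 → (∀ n : ℤ, y ≠ (q : ℂ) ^ n * ξ) →
      HasBilatSum (fun n => (1 - (q : ℂ)) * ((q : ℂ) ^ n * ξ) * T y n) S := by
    intro y
    by_cases hy : y ≠ 0 ∧ ∀ n : ℤ, y ≠ (q : ℂ) ^ n * ξ
    · obtain ⟨S, hS⟩ := exists_hasBilatSum_of_decay hq0 hq1 hξ (hTtop y hy.1 hy.2)
        (hTbot y hy.1 hy.2)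
      exact ⟨S, fun _ _ => hS⟩
    · exact ⟨0, fun h1 h2 => absurd ⟨h1, h2⟩ hy⟩
  choose g hg using hex
  refine ⟨g, fun y hy hyn => ?_, fun x hx hxn => ?_⟩
  · simpa only [hT, qKernel, mul_div_assoc] using hg y hy hyn
  have hxq : x / q ≠ 0 := div_ne_zero hx hQ
  have hqx : q * x ≠ 0 := mul_ne_zero hQ hx
  have hxqn : ∀ n : ℤ, x / q ≠ (q : ℂ) ^ n * ξ := fun n hn => hxn (n + 1) (by
    rw [div_eq_iff hQ] at hn
    rw [hn, zpow_add_one₀ hQ]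
    ring)
  have hqxn : ∀ n : ℤ, q * x ≠ (q : ℂ) ^ n * ξ := fun n hn => hxn (n - 1) (by
    rw [← mul_right_inj' hQ, hn, ← mul_assoc, ← zpow_one_add₀ hQ, add_sub_cancel])
  set a := qpow q a1'
  set b := qpow q a2'
  have ha0 : a ≠ 0 := qpow_ne_zero hq0 _
  set H1 := qpow q (h1' + 1 / 2) * t1 with hH1
  set H2 := qpow q (h2' + 1 / 2) * t2 with hH2
  set L1 := qpow q (l1' - 1 / 2) * t1 with hL1
  set L2 := qpow q (l2' - 1 / 2) * t2 with hL2
  have hHH : H1 * H2 = qpow q (h1' + h2' + 1) * t1 * t2 := by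
    rw [show h1' + h2' + 1 = (h1' + 1 / 2) + (h2' + 1 / 2) by ring, qpow_add hq0, hH1, hH2]
    ring
  have hLL : L1 * L2 = qpow q (l1' + l2' - 1) * t1 * t2 := by
    rw [show l1' + l2' - 1 = (l1' - 1 / 2) + (l2' - 1 / 2) by ring, qpow_add hq0, hL1, hL2]
    ring
  have hconst : qpow q ((h1' + h2' + l1' + l2' + a1' + a2') / 2) *
      (qpow q (b' / 2) + qpow q (-(b' / 2))) * t1 * t2 = a * b * L1 * L2 + H1 * H2 := by
    rw [mul_assoc (a * b), hHH, hLL, mul_add, ← qpow_add hq0, ← qpow_add hq0,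
      show (h1' + h2' + l1' + l2' + a1' + a2') / 2 + b' / 2 = a1' + a2' + (l1' + l2' - 1) by
        linarith,
      show (h1' + h2' + l1' + l2' + a1' + a2') / 2 + -(b' / 2) = h1' + h2' + 1 by linarith,
      qpow_add hq0, qpow_add hq0 a1']
    ring
  have hconst' : qpow q ((h1' + 1 - a1' + (h2' + 1 - a1') + l1' + l2' + 0 + (a2' - 1)) / 2) *
      (qpow q ((b' + 1 - a1') / 2) + qpow q (-((b' + 1 - a1') / 2))) * t1 * t2
      = b * q / a * L1 * L2 + H1 * H2 / a := by
    rw [mul_assoc (b * q / a), hHH, hLL, mul_add, ← qpow_add hq0, ← qpow_add hq0,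
      show (h1' + 1 - a1' + (h2' + 1 - a1') + l1' + l2' + 0 + (a2' - 1)) / 2 + (b' + 1 - a1') / 2
        = a2' + 1 - a1' + (l1' + l2' - 1) by linarith,
      show (h1' + 1 - a1' + (h2' + 1 - a1') + l1' + l2' + 0 + (a2' - 1)) / 2
        + -((b' + 1 - a1') / 2) = h1' + h2' + 1 - a1' by linarith,
      qpow_add hq0, qpow_sub hq0, qpow_add hq0 a2', qpow_one, qpow_sub hq0 (h1' + h2' + 1)]
    ring
  have hshift : ∀ r t, qpow q (r + 1 - a1' + 1 / 2) * t = q / a * (qpow q (r + 1 / 2) * t) := by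
    intro r t
    rw [show r + 1 - a1' + 1 / 2 = 1 - a1' + (r + 1 / 2) by ring, qpow_add hq0, qpow_sub hq0,
      qpow_one, mul_assoc]
  set G : ℤ → ℂ := fun n =>
    -b * (((q : ℂ)⁻¹ * ((q : ℂ) ^ n * ξ) - L1) * ((q : ℂ)⁻¹ * ((q : ℂ) ^ n * ξ) - L2)
        * T (q * x) n)
      + a⁻¹ * ((q * ((q : ℂ) ^ (n - 1) * ξ) - H1) * (q * ((q : ℂ) ^ (n - 1) * ξ) - H2)
        * T (x / q) (n - 1)) with hG
  have hGtop : Tendsto G atTop (𝓝 0) := by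
    have e1 := (tendsto_quadratic_mul_atTop hq0 hq1 ξ (q : ℂ)⁻¹ L1 L2
      (hTtop _ hqx hqxn)).const_mul (-b)
    have e2 := ((tendsto_quadratic_mul_atTop hq0 hq1 ξ q H1 H2 (hTtop _ hxq hxqn)).comp
      (tendsto_atTop_add_const_right _ (-1) tendsto_id)).const_mul a⁻¹
    have e := e1.add e2
    simp only [mul_zero, add_zero] at e
    exact e
  have hGbot : Tendsto G atBot (𝓝 0) := by
    have e1 := (tendsto_quadratic_mul_atBot hq0 hq1 hξ (q : ℂ)⁻¹ L1 L2
      (hTbot _ hqx hqxn)).const_mul (-b)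
    have e2 := ((tendsto_quadratic_mul_atBot hq0 hq1 hξ q H1 H2 (hTbot _ hxq hxqn)).comp
      (tendsto_atBot_add_const_right _ (-1) tendsto_id)).const_mul a⁻¹
    have e := e1.add e2
    simp only [mul_zero, add_zero] at e
    exact e
  have hzeroSum := (HasBilatSum.telescope hGtop hGbot).const_mul (1 - (q : ℂ))
  have hsum := (((hg _ hxq hxqn).const_mul (x⁻¹ * (x - q / a * H1) * (x - q / a * H2))).add
    ((hg _ hqx hqxn).const_mul (b / q * x⁻¹ * (x - L1) * (x - L2)))).add
    ((hg x hx hxn).const_mul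
      (-((1 + b / q) * x + (b * q / a * L1 * L2 + H1 * H2 / a) * x⁻¹) - a⁻¹ * E'))
  have hfin := hsum.unique (T := (1 - (q : ℂ)) * 0) (by
    convert hzeroSum using 1
    funext n
    have hs : (q : ℂ) ^ n * ξ ≠ 0 := mul_ne_zero (zpow_ne_zero n hQ) hξ
    have hsucc : (q : ℂ) ^ (n + 1) * ξ = q * ((q : ℂ) ^ n * ξ) := by
      rw [zpow_add_one₀ hQ]; ring
    have hpred : (q : ℂ) ^ (n - 1) * ξ = (q : ℂ) ^ n * ξ / q := by
      rw [zpow_sub_one₀ hQ]; ring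
    have he := heig n
    rw [A4, hconst, qpow_add hq0 a1'] at he
    have hv1 : (q : ℂ) ^ n * ξ / x / q ≠ 1 := by
      rw [div_div, mul_comm x, Ne, div_eq_one_iff_eq hqx]
      exact (hqxn n).symm
    have hv2 : (q : ℂ) * ((q : ℂ) ^ n * ξ / x / q) ≠ 1 := by
      rw [mul_div_cancel₀ _ hQ, Ne, div_eq_one_iff_eq hx]
      exact (hxn n).symm
    obtain ⟨M, hM1, hM2, hM3⟩ := exists_qKernel_eq hq0 hq1 c hv1 hv2
    have key := kernel_telescoping_identity b H1 H2 L1 L2 M _ _ _ E' _ c hQ hs hx ha0 rfl hc' he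
    simp only [hG, hT, add_sub_cancel_right, hsucc, hpred]
    generalize (q : ℂ) ^ n * ξ = s at *
    have k0 : q * (s / x / q) = s / x := mul_div_cancel₀ _ hQ
    have k1 : s / (x / q) = q * (s / x) := by field_simp
    have k2 : s / (q * x) = s / x / q := by field_simp
    have k3 : q * s / (q * x) = s / x := by field_simp
    have k4 : s / q / (x / q) = s / x := by field_simp
    have k5 : (q : ℂ)⁻¹ * (q * s) = s := by field_simp
    have k6 : q * (s / q) = s := by field_simp
    have k7 : (q : ℂ)⁻¹ * s = s / q := by field_simp
    rw [← hM1, ← hM2, ← hM3, k0] at key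
    rw [k1, k2, k3, k4, k5, k6, k7]
    linear_combination (1 - (q : ℂ)) * key)
  rw [A4, hshift, hshift, hconst', zero_add, qpow_zero, qpow_sub hq0 a2', qpow_one,
    qpow_neg hq0 a1']
  linear_combination hfin
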